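/- (Noether) Let $D$ be a finite-dimensional associative central $K$-division algebra (i.e. $Z(D)=K\cdot 1_D$). Then there exists a maximal subfield of $D$ that is a separable field extension of $K$. -/

import Mathlib

open scoped TensorProduct

universe u

/-- An element `a` of an associative unital `K`-algebra `A` is *separable over `K`* if it is
algebraic over `K` and its minimal polynomial over `K` is separable, i.e. a product of pairwise
distinct irreducible separable polynomials of `K[t]`. -/
def IsSeparableElement (K : Type u) {A : Type u} [Field K] [Ring A] [Algebra K A] (a : A) : Prop :=
  IsIntegral K a ∧ (minpoly K a).Separable

/-- A *subfield* of a `K`-division algebra `D` is a commutative unital `K`-subalgebra of `D`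
which is a field, i.e. is moreover closed under inverses. -/
def IsSubfieldOf (K : Type u) {D : Type u} [Field K] [DivisionRing D] [Algebra K D]
    (S : Subalgebra K D) : Prop :=
  (∀ a ∈ S, ∀ b ∈ S, a * b = b * a) ∧ ∀ a ∈ S, a⁻¹ ∈ S

/-- A *maximal subfield* of `D` is a subfield not properly contained in any other subfield. -/
def IsMaximalSubfieldOf (K : Type u) {D : Type u} [Field K] [DivisionRing D] [Algebra K D]
    (S : Subalgebra K D) : Prop :=
  IsSubfieldOf K S ∧ ∀ T : Subalgebra K D, IsSubfieldOf K T → S ≤ T → S = T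

section CentralDivisionAlgebra

variable {K D : Type*} [Field K] [DivisionRing D] [Algebra K D]

/-- Over a central division algebra, vectors that are linearly independent over the base field
satisfy no nontrivial generalized relation `∑ dᵢ x vᵢ = 0` for all `x`. -/
theorem eq_zero_of_forall_sum_mul_mul_eq_zero (hcentral : Subalgebra.center K D = ⊥)
    {ι : Type*} {v : ι → D} (hv : LinearIndependent K v) (s : Finset ι) (d : ι → D)
    (h : ∀ x, ∑ i ∈ s, d i * x * v i = 0) : ∀ i ∈ s, d i = 0 := by
  classical
  induction s using Finset.induction_on generalizing d with
  | empty => simp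
  | insert a s ha ih =>
    by_cases hda : d a = 0
    · intro i hi
      rcases Finset.mem_insert.1 hi with rfl | hi
      · exact hda
      · refine ih d (fun x ↦ ?_) i hi
        simpa [Finset.sum_insert ha, hda] using h x
    · exfalso
      set c : ι → D := fun i ↦ (d a)⁻¹ * d i with hc
      have hca : c a = 1 := inv_mul_cancel₀ hda
      have hrel (x : D) : ∑ i ∈ insert a s, c i * x * v i = 0 := by
        simpa [hc, Finset.mul_sum, mul_assoc] using congrArg ((d a)⁻¹ * ·) (h x)
      have hcomm (t : D) : ∀ i ∈ s, c i * t - t * c i = 0 := by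
        refine ih _ fun x ↦ ?_
        have h₁ := hrel (t * x)
        have h₂ := congrArg (t * ·) (hrel x)
        simp only [Finset.sum_insert ha, hca, mul_add, mul_zero, Finset.mul_sum, one_mul] at h₁ h₂
        have h₃ := sub_eq_zero.2 (h₁.trans h₂.symm)
        rw [← mul_assoc t x, add_sub_add_left_eq_sub, ← Finset.sum_sub_distrib] at h₃
        rw [← h₃]
        refine Finset.sum_congr rfl fun i _ ↦ ?_
        simp only [sub_mul, mul_assoc]
      have hmem : ∀ i ∈ insert a s, ∃ k : K, algebraMap K D k = c i := by
        intro i hi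
        rcases Finset.mem_insert.1 hi with rfl | hi
        · exact ⟨1, by rw [hca, map_one]⟩
        · change c i ∈ (⊥ : Subalgebra K D)
          rw [← hcentral, Subalgebra.mem_center_iff]
          exact fun t ↦ (sub_eq_zero.1 (hcomm t i hi)).symm
      choose! k hk using hmem
      have hsum : ∑ i ∈ insert a s, k i • v i = 0 := by
        rw [← hrel 1]
        refine Finset.sum_congr rfl fun i hi ↦ ?_
        rw [mul_one, ← hk i hi, Algebra.smul_def]
      have hka := linearIndependent_iff'.1 hv _ k hsum a (Finset.mem_insert_self a s)
      have := hk a (Finset.mem_insert_self a s)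
      rw [hka, map_zero, hca] at this
      exact zero_ne_one this

/-- The double centralizer property for separable subfields of a central division algebra. -/
theorem mem_range_of_commute_centralizer (hcentral : Subalgebra.center K D = ⊥)
    {L : Type*} [Field L] [Algebra K L] [FiniteDimensional K L] [Algebra.IsSeparable K L]
    (f : L →ₐ[K] D) {y : D} (hy : ∀ c, (∀ l, f l * c = c * f l) → y * c = c * y) :
    y ∈ f.range := by
  by_contra hyf
  let _ : Module L D := Module.compHom D (f : L →+* D)
  have smul_eq (l : L) (z : D) : l • z = f l * z := rfl
  have : IsScalarTower K L D := ⟨fun k l z ↦ by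
    rw [smul_eq, smul_eq, map_smul, smul_mul_assoc]⟩
  have hpair : LinearIndependent L ![(1 : D), y] := by
    rw [LinearIndependent.pair_iff]
    intro s t hst
    rw [smul_eq, smul_eq, mul_one] at hst
    have ht : t = 0 := by
      by_contra ht
      refine hyf ⟨-(t⁻¹ * s), ?_⟩
      have hft : f t ≠ 0 := (map_ne_zero f).2 ht
      change f (-(t⁻¹ * s)) = y
      rw [map_neg, map_mul, map_inv₀, eq_neg_of_add_eq_zero_left hst, mul_neg, neg_neg,
        inv_mul_cancel_left₀ hft]
    refine ⟨?_, ht⟩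
    rw [ht, map_zero, zero_mul, add_zero] at hst
    exact (map_eq_zero f).1 hst
  have : Algebra.FormallyUnramified K L := Algebra.FormallyUnramified.of_isSeparable K L
  let b := Module.finBasis K L
  set e := Algebra.FormallyUnramified.elem K L
  obtain ⟨a, ha⟩ : ∃ a : Fin (Module.finrank K L) → L, e = ∑ i, a i ⊗ₜ[K] b i := by
    let B := Algebra.TensorProduct.basis L b
    refine ⟨fun i ↦ B.repr e i, ?_⟩
    conv_lhs => rw [← B.sum_repr e]
    refine Finset.sum_congr rfl fun i _ ↦ ?_
    simp [B, Algebra.TensorProduct.basis_apply, TensorProduct.smul_tmul']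
  let Φ (x : D) : L ⊗[K] L →ₗ[K] D :=
    TensorProduct.lift ((LinearMap.mul K D).compl₁₂
      ((LinearMap.mulRight K x) ∘ₗ f.toLinearMap) f.toLinearMap)
  have hΦ (x : D) (l m : L) : Φ x (l ⊗ₜ m) = f l * x * f m := by
    simp [Φ]
  have hΦl (x : D) (l : L) (z : L ⊗[K] L) : Φ x ((l ⊗ₜ 1) * z) = f l * Φ x z := by
    induction z with
    | zero => simp
    | add z w hz hw => rw [mul_add, map_add, map_add, hz, hw, mul_add]
    | tmul m n => simp only [Algebra.TensorProduct.tmul_mul_tmul, hΦ, map_mul, one_mul, mul_assoc]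
  have hΦr (x : D) (l : L) (z : L ⊗[K] L) : Φ x ((1 ⊗ₜ l) * z) = Φ x z * f l := by
    induction z with
    | zero => simp
    | add z w hz hw => rw [mul_add, map_add, map_add, hz, hw, add_mul]
    | tmul m n =>
      simp only [Algebra.TensorProduct.tmul_mul_tmul, hΦ, one_mul, mul_comm l n, map_mul,
        mul_assoc]
  have hcomm (x : D) : y * Φ x e = Φ x e * y := by
    refine hy _ fun l ↦ ?_
    rw [← hΦl, ← hΦr, Algebra.FormallyUnramified.one_tmul_mul_elem]
  have hind := linearIndependent_smul b.linearIndependent hpair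
  let d : Fin (Module.finrank K L) × Fin 2 → D := fun p ↦ ![y * f (a p.1), -f (a p.1)] p.2
  have hd : ∀ p ∈ Finset.univ, d p = 0 := by
    refine eq_zero_of_forall_sum_mul_mul_eq_zero hcentral hind Finset.univ d fun x ↦ ?_
    have h := sub_eq_zero.2 (hcomm x)
    rw [ha, map_sum, Finset.mul_sum, Finset.sum_mul, ← Finset.sum_sub_distrib] at h
    rw [Fintype.sum_prod_type, ← h]
    refine Finset.sum_congr rfl fun i _ ↦ ?_
    simp [d, smul_eq, hΦ, mul_assoc, sub_eq_add_neg]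
  have ha0 (i) : a i = 0 := by
    simpa [d] using hd (i, 1) (Finset.mem_univ _)
  have he : e = 0 := by simp [ha, ha0]
  have h1 : Algebra.TensorProduct.lmul' K e = (1 : L) := Algebra.FormallyUnramified.lmul_elem
  rw [he, map_zero] at h1
  exact zero_ne_one h1

/-- Adjoining a separable element of a division algebra to a separable extension yields a
separable extension. -/
theorem isSeparable_of_mem_adjoin_singleton {L : Type*} [Field L] [Algebra K L] [Algebra L D]
    [IsScalarTower K L D] [FiniteDimensional L D] [Algebra.IsSeparable K L] {x : D}
    (hx : IsSeparable L x) {z : D} (hz : z ∈ Algebra.adjoin L {x}) : IsSeparable K z := by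
  let T := Algebra.adjoin L {x}
  let _ : Field T := fieldOfFiniteDimensional L T
  let x' : T := ⟨x, Algebra.self_mem_adjoin_singleton L x⟩
  have hx' : IsSeparable L x' := by
    rw [IsSeparable, ← minpoly.algHom_eq T.val Subtype.val_injective x']
    exact hx
  have htop : IntermediateField.adjoin L {x'} = ⊤ := by
    rw [eq_top_iff]
    intro w _
    obtain ⟨w, hw⟩ := w
    induction hw using Algebra.adjoin_induction with
    | mem a ha =>
      obtain rfl : a = x := ha
      exact IntermediateField.mem_adjoin_simple_self L x'
    | algebraMap r => exact (IntermediateField.adjoin L {x'}).algebraMap_mem r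
    | add a b ha hb iha ihb => exact add_mem (iha trivial) (ihb trivial)
    | mul a b ha hb iha ihb => exact mul_mem (iha trivial) (ihb trivial)
  have hsep : Algebra.IsSeparable L T := by
    have h := (IntermediateField.isSeparable_adjoin_simple_iff_isSeparable L T).2 hx'
    rw [htop] at h
    exact Algebra.IsSeparable.of_algHom L _
      (IntermediateField.topEquiv (F := L) (E := T)).symm.toAlgHom
  have hsepK : Algebra.IsSeparable K T := Algebra.IsSeparable.trans K L T
  have hz' := Algebra.IsSeparable.isSeparable K (⟨z, hz⟩ : T)
  rwa [IsSeparable, ← minpoly.algHom_eq (T.val.restrictScalars K) Subtype.val_injective] at hz'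

/-- A separable subfield of a central division algebra that is strictly contained in its
centralizer is contained in a strictly larger separable commutative subalgebra. -/
theorem exists_range_lt_isSeparable [FiniteDimensional K D]
    (hcentral : Subalgebra.center K D = ⊥)
    {L : Type*} [Field L] [Algebra K L] [FiniteDimensional K L] [Algebra.IsSeparable K L]
    (f : L →ₐ[K] D) {y : D} (hy : ∀ l, f l * y = y * f l) (hyf : y ∉ f.range) :
    ∃ T : Subalgebra K D, f.range < T ∧ (∀ a ∈ T, ∀ b ∈ T, a * b = b * a) ∧
      ∀ a ∈ T, IsSeparable K a := by
  let C := Subalgebra.centralizer K (f.range : Set D)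
  have hC {c : D} : c ∈ C ↔ ∀ l, f l * c = c * f l := by
    simp [C, Subalgebra.mem_centralizer_iff]
  let g : L →ₐ[K] C := f.codRestrict C fun l ↦ hC.2 fun m ↦ by
    rw [← map_mul, ← map_mul, mul_comm]
  let _ : DivisionRing C := divisionRingOfFiniteDimensional K C
  let _ : Algebra L C := (g : L →+* C).toAlgebra' fun l c ↦ Subtype.ext (hC.1 c.2 l)
  have : IsScalarTower K L C := IsScalarTower.of_algebraMap_eq fun k ↦ (g.commutes k).symm
  have : FiniteDimensional L C := FiniteDimensional.right K L C
  have hbot {c : C} : c ∈ (⊥ : Subalgebra L C) ↔ (c : D) ∈ f.range :=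
    ⟨fun ⟨l, hl⟩ ↦ ⟨l, congrArg Subtype.val hl⟩, fun ⟨l, hl⟩ ↦ ⟨l, Subtype.ext hl⟩⟩
  have : Algebra.IsCentral L C := ⟨fun z hz ↦ hbot.2 <|
    mem_range_of_commute_centralizer hcentral f fun c hc ↦
      (congrArg Subtype.val (Subalgebra.mem_center_iff.1 hz ⟨c, hC.2 hc⟩)).symm⟩
  obtain ⟨x, hx, hxsep⟩ := JacobsonNoether.exists_separable_and_not_isCentral' (L := L) (D := C)
    fun h ↦ hyf (hbot.1 (h ▸ Algebra.mem_top : (⟨y, hC.2 hy⟩ : C) ∈ (⊥ : Subalgebra L C)))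
  let T := (Algebra.adjoin L {x}).restrictScalars K
  refine ⟨T.map C.val, lt_of_le_of_ne ?_ ?_, ?_, ?_⟩
  · rintro _ ⟨l, rfl⟩
    exact ⟨g l, (Algebra.adjoin L {x}).algebraMap_mem l, rfl⟩
  · intro h
    refine hx (hbot.2 ?_)
    rw [h]
    exact ⟨x, Algebra.self_mem_adjoin_singleton L x, rfl⟩
  · rintro _ ⟨a, ha, rfl⟩ _ ⟨b, hb, rfl⟩
    have hab : a * b = b * a :=
      congrArg Subtype.val (mul_comm (⟨a, ha⟩ : Algebra.adjoin L {x}) ⟨b, hb⟩)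
    exact congrArg C.val hab
  · rintro _ ⟨a, ha, rfl⟩
    have := isSeparable_of_mem_adjoin_singleton (K := K) hxsep ha
    rw [IsSeparable, ← minpoly.algHom_eq C.val Subtype.val_injective] at this
    exact this

/-- A subalgebra of a finite-dimensional division algebra is closed under inverses. -/
theorem Subalgebra.inv_mem_of_finiteDimensional [FiniteDimensional K D] (S : Subalgebra K D)
    {a : D} (ha : a ∈ S) : a⁻¹ ∈ S := by
  let _ : DivisionRing S := divisionRingOfFiniteDimensional K S
  by_cases h : a = 0
  · simp [h]
  · have h' : (⟨a, ha⟩ : S) ≠ 0 := fun h₀ ↦ h (congrArg Subtype.val h₀)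
    have := congrArg Subtype.val (mul_inv_cancel₀ h')
    rw [inv_eq_of_mul_eq_one_right this]
    exact Subtype.property _

end CentralDivisionAlgebra

/-- (Noether) Every finite-dimensional associative central `K`-division algebra
(`Z(D) = K·1`) possesses a maximal subfield which is a separable field extension of `K`. -/
theorem exists_separable_maximal_subfield
    (K D : Type u) [Field K] [DivisionRing D] [Algebra K D] [FiniteDimensional K D]
    (hcentral : Subalgebra.center K D = ⊥) :
    ∃ S : Subalgebra K D, IsMaximalSubfieldOf K S ∧ ∀ a ∈ S, IsSeparableElement K a := by
  let P : Set (Subalgebra K D) :=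
    {S | (∀ a ∈ S, ∀ b ∈ S, a * b = b * a) ∧ ∀ a ∈ S, IsSeparable K a}
  have hP : P.Nonempty := by
    refine ⟨⊥, ?_, ?_⟩
    · rintro _ ⟨a, rfl⟩ b -
      exact Algebra.commutes a b
    · rintro _ ⟨a, rfl⟩
      exact isSeparable_algebraMap a
  obtain ⟨S, ⟨hcomm, hsep⟩, hmax⟩ :=
    (InvImage.wf (Subalgebra.toSubmodule (R := K) (A := D)) wellFounded_gt).has_min P hP
  let _ : CommRing S := { (inferInstance : Ring S) with
    mul_comm := fun a b ↦ Subtype.ext (hcomm a a.2 b b.2) }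
  let _ : Field S := fieldOfFiniteDimensional K S
  have : Algebra.IsSeparable K S := ⟨fun a ↦ by
    rw [IsSeparable, ← minpoly.algHom_eq S.val Subtype.val_injective]
    exact hsep a a.2⟩
  refine ⟨S, ⟨⟨hcomm, fun a ha ↦ S.inv_mem_of_finiteDimensional ha⟩, fun T hT hST ↦ ?_⟩,
    fun a ha ↦ ⟨Algebra.IsIntegral.isIntegral a, hsep a ha⟩⟩
  refine le_antisymm hST fun y hy ↦ ?_
  by_contra hyS
  obtain ⟨T', hlt, hT'⟩ := exists_range_lt_isSeparable hcentral S.val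
    (fun l ↦ hT.1 l (hST l.2) y hy) (by rwa [Subalgebra.range_val])
  rw [Subalgebra.range_val] at hlt
  exact hmax T' hT' hlt
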